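/- Let S be a multiplicative subset of R and let M = R_S (the localization of R at S) be regarded as an R-module. Then M is simple-𝔊-torsion-free if and only if Ann_R(M) ∈ 𝔊*. -/

import Mathlib

section Defs

variable (R : Type*) [CommRing R]

/-- A Gabriel topology on the commutative ring `R`: contains `R`, is upward closed,
is closed under colon by elements, and satisfies the Gabriel axiom. -/
def IsGabrielTopology (G : Set (Ideal R)) : Prop :=
  ⊤ ∈ G ∧
  (∀ a b : Ideal R, a ∈ G → a ≤ b → b ∈ G) ∧
  (∀ a ∈ G, ∀ r : R, Submodule.colon a (Ideal.span {r}) ∈ G) ∧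
  (∀ b : Ideal R, (∃ a ∈ G, ∀ x ∈ a, Submodule.colon b (Ideal.span {x}) ∈ G) → b ∈ G)

/-- `𝔊*`: the maximal elements of `Spec R \ 𝔊`. -/
def GStar (G : Set (Ideal R)) : Set (Ideal R) :=
  {p | p.IsPrime ∧ p ∉ G ∧ ∀ q : Ideal R, q.IsPrime → p < q → q ∈ G}

variable (M : Type*) [AddCommGroup M] [Module R M]

/-- `M` is `𝔊`-torsion-free: no nonzero element is annihilated by an ideal of `𝔊`. -/
def IsGTorsionFree (G : Set (Ideal R)) : Prop :=
  ∀ a ∈ G, ∀ x : M, (∀ r ∈ a, r • x = 0) → x = 0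

/-- `M` is `𝔊`-torsion: every element is annihilated by some ideal of `𝔊`. -/
def IsGTorsion (G : Set (Ideal R)) : Prop :=
  ∀ x : M, ∃ a ∈ G, ∀ r ∈ a, r • x = 0

/-- `M` is simple-`𝔊`-torsion-free. -/
def IsSimpleGTorsionFree (G : Set (Ideal R)) : Prop :=
  IsGTorsionFree R M G ∧ (∃ x : M, x ≠ 0) ∧
    ∀ U : Submodule R M, U ≠ ⊥ → U ≠ ⊤ → ¬ IsGTorsionFree R (M ⧸ U) G

/-- `M` is `𝔊`-divisible: `𝔞M = M` for all `𝔞 ∈ 𝔊`. -/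
def IsGDivisible (G : Set (Ideal R)) : Prop :=
  ∀ a ∈ G, a • (⊤ : Submodule R M) = ⊤

/-- `M` is simple-`𝔊`-divisible. -/
def IsSimpleGDivisible (G : Set (Ideal R)) : Prop :=
  IsGDivisible R M G ∧ (∃ x : M, x ≠ 0) ∧
    ∀ V : Submodule R M, V ≠ ⊥ → V ≠ ⊤ → ¬ (∀ a ∈ G, a • V = V)

/-- `M` is a prime module. -/
def IsPrimeModule : Prop :=
  (∃ x : M, x ≠ 0) ∧ ∀ (r : R) (x : M), r • x = 0 → x = 0 ∨ ∀ y : M, r • y = 0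

/-- `M` is uniform: two nonzero submodules intersect nontrivially. -/
def IsUniformModule : Prop :=
  ∀ U V : Submodule R M, U ≠ ⊥ → V ≠ ⊥ → U ⊓ V ≠ ⊥

/-- `M` is supplemented. -/
def IsSupplementedModule : Prop :=
  ∀ U : Submodule R M, ∃ V : Submodule R M, U ⊔ V = ⊤ ∧
    ∀ W : Submodule R M, W ≤ V → U ⊔ W = ⊤ → W = V

/-- torsion-free (over a domain, element form). -/
def IsTorsionFreeMod : Prop :=
  ∀ d : R, d ≠ 0 → Function.Injective (fun x : M => d • x)

def IsSimpleTorsionFreeMod : Prop :=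
  IsTorsionFreeMod R M ∧ (∃ x : M, x ≠ 0) ∧
    ∀ U : Submodule R M, U ≠ ⊥ → U ≠ ⊤ → ¬ IsTorsionFreeMod R (M ⧸ U)

/-- divisible (over a domain, element form). -/
def IsDivisibleMod : Prop :=
  ∀ d : R, d ≠ 0 → Function.Surjective (fun x : M => d • x)

def IsSimpleDivisibleMod : Prop :=
  IsDivisibleMod R M ∧ (∃ x : M, x ≠ 0) ∧
    ∀ V : Submodule R M, V ≠ ⊥ → V ≠ ⊤ →
      ¬ (∀ d : R, d ≠ 0 → ∀ x ∈ V, ∃ y ∈ V, d • y = x)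

end Defs

/-- The residue field `κ(p) = R_p / p R_p`, as an `R`-module. -/
abbrev kappa (R : Type*) [CommRing R] (p : Ideal R) [p.IsPrime] : Type _ :=
  IsLocalRing.ResidueField (Localization.AtPrime p)


theorem IsGabrielTopology.mul_mem {R : Type*} [CommRing R] {G : Set (Ideal R)}
    (hG : IsGabrielTopology R G) {a b : Ideal R} (ha : a ∈ G) (hb : b ∈ G) : a * b ∈ G := by
  refine hG.2.2.2 _ ⟨a, ha, fun x hx => hG.2.1 _ _ hb fun y hy => ?_⟩
  rw [Submodule.mem_colon]
  intro z hz
  obtain ⟨c, rfl⟩ := Ideal.mem_span_singleton'.1 hz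
  have h := (a * b).mul_mem_left c (Ideal.mul_mem_mul hx hy)
  rw [smul_eq_mul]
  convert h using 1
  ring

/-- An ideal of a Noetherian ring belongs to a Gabriel topology as soon as all the primes
containing it do. -/
theorem IsGabrielTopology.mem_of_forall_isPrime {R : Type*} [CommRing R] [IsNoetherianRing R]
    {G : Set (Ideal R)} (hG : IsGabrielTopology R G) (I : Ideal R)
    (h : ∀ q : Ideal R, q.IsPrime → I ≤ q → q ∈ G) : I ∈ G := by
  induction I using IsNoetherian.induction with
  | hgt I ih =>
    have hlt : ∀ J : Ideal R, I < J → J ∈ G :=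
      fun J hJ => ih J hJ fun q hq hJq => h q hq (hJ.le.trans hJq)
    by_contra hI
    refine hI (h I ⟨fun htop => hI (htop ▸ hG.1), fun {x y} hxy => ?_⟩ le_rfl)
    by_contra! hn
    have hsup : ∀ z ∉ I, I ⊔ Ideal.span {z} ∈ G := fun z hz => hlt _ <|
      lt_of_le_of_ne le_sup_left fun he =>
        hz (he ▸ Ideal.mem_sup_right (Ideal.mem_span_singleton_self z))
    refine hI (hG.2.1 _ _ (hG.mul_mem (hsup x hn.1) (hsup y hn.2)) ?_)
    rw [Ideal.sup_mul, Ideal.mul_sup (Ideal.span {x}), Ideal.span_singleton_mul_span_singleton]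
    exact sup_le Ideal.mul_le_left
      (sup_le Ideal.mul_le_right ((Ideal.span_singleton_le_iff_mem I).2 hxy))

/-- The annihilator of a simple-`𝔊`-torsion-free module is prime. -/
theorem IsSimpleGTorsionFree.isPrime_annihilator {R M : Type*} [CommRing R] [AddCommGroup M]
    [Module R M] {G : Set (Ideal R)} (hM : IsSimpleGTorsionFree R M G) :
    (Module.annihilator R M).IsPrime := by
  obtain ⟨htf, ⟨x₀, hx₀⟩, hs⟩ := hM
  refine ⟨fun htop => hx₀ ?_, fun {x y} hxy => or_iff_not_imp_left.2 fun hx => ?_⟩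
  · have h1 : (1 : R) ∈ Module.annihilator R M := htop ▸ Submodule.mem_top
    simpa using Module.mem_annihilator.1 h1 x₀
  have hU : LinearMap.ker (LinearMap.lsmul R M x) = ⊥ := by
    by_contra hne
    refine hs _ hne (fun htop => hx (Module.mem_annihilator.2 fun m => ?_)) fun a ha m hm => ?_
    · have : m ∈ LinearMap.ker (LinearMap.lsmul R M x) := htop ▸ Submodule.mem_top
      simpa using this
    · obtain ⟨m, rfl⟩ := Submodule.Quotient.mk_surjective _ m
      rw [Submodule.Quotient.mk_eq_zero, LinearMap.mem_ker, LinearMap.lsmul_apply]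
      refine htf a ha _ fun r hr => ?_
      have h := hm r hr
      rw [← Submodule.Quotient.mk_smul, Submodule.Quotient.mk_eq_zero, LinearMap.mem_ker,
        LinearMap.lsmul_apply] at h
      rwa [smul_comm]
  refine Module.mem_annihilator.2 fun m => ?_
  have : y • m ∈ LinearMap.ker (LinearMap.lsmul R M x) := by
    rw [LinearMap.mem_ker, LinearMap.lsmul_apply, smul_smul]
    exact Module.mem_annihilator.1 hxy m
  rwa [hU, Submodule.mem_bot] at this

/-- The submodule of those `m` in an `R`-algebra `A` with `t • m ∈ q • 1` for some `t ∉ q`. -/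
def saturatedPrimeSubmodule {R : Type*} (A : Type*) [CommRing R] [CommRing A] [Algebra R A]
    (q : Ideal R) [q.IsPrime] : Submodule R A where
  carrier := {m | ∃ t ∉ q, ∃ r ∈ q, t • m = algebraMap R A r}
  zero_mem' := ⟨1, q.one_notMem, 0, q.zero_mem, by simp⟩
  add_mem' := by
    rintro m n ⟨t, ht, r, hr, h⟩ ⟨t', ht', r', hr', h'⟩
    refine ⟨t * t', fun hm => (Ideal.IsPrime.mem_or_mem ‹_› hm).elim ht ht', t' * r + t * r',
      q.add_mem (q.mul_mem_left _ hr) (q.mul_mem_left _ hr'), ?_⟩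
    simp only [Algebra.smul_def, map_mul, map_add] at h h' ⊢
    rw [← h, ← h']
    ring
  smul_mem' := by
    rintro c m ⟨t, ht, r, hr, h⟩
    refine ⟨t, ht, c * r, q.mul_mem_left _ hr, ?_⟩
    rw [smul_comm, h, Algebra.smul_def, map_mul]

theorem isGTorsionFree_quotient_saturatedPrimeSubmodule {R : Type*} (A : Type*) [CommRing R]
    [CommRing A] [Algebra R A] {G : Set (Ideal R)} (hG : IsGabrielTopology R G)
    (q : Ideal R) [q.IsPrime] (hq : q ∉ G) :
    IsGTorsionFree R (A ⧸ saturatedPrimeSubmodule A q) G := by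
  intro a ha m hm
  obtain ⟨m, rfl⟩ := Submodule.Quotient.mk_surjective _ m
  obtain ⟨t, hta, htq⟩ := SetLike.not_le_iff_exists.1 fun hle => hq (hG.2.1 a q ha hle)
  have h := hm t hta
  rw [← Submodule.Quotient.mk_smul, Submodule.Quotient.mk_eq_zero] at h
  obtain ⟨t', ht', r, hr, h⟩ := h
  rw [Submodule.Quotient.mk_eq_zero]
  exact ⟨t' * t, fun hm => (Ideal.IsPrime.mem_or_mem ‹_› hm).elim ht' htq, r, hr,
    by rw [mul_smul, h]⟩

theorem mem_annihilator_iff_algebraMap_eq_zero {R A : Type*} [CommRing R] [CommRing A]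
    [Algebra R A] {r : R} : r ∈ Module.annihilator R A ↔ algebraMap R A r = 0 := by
  rw [Module.mem_annihilator]
  refine ⟨fun h => by simpa [Algebra.smul_def] using h 1, fun h m => ?_⟩
  rw [Algebra.smul_def, h, zero_mul]

/-- For an algebra `A`, simple-`𝔊`-torsion-freeness forces the annihilator into `𝔊*`. -/
theorem IsSimpleGTorsionFree.annihilator_mem_gStar {R A : Type*} [CommRing R] [CommRing A]
    [Algebra R A] {G : Set (Ideal R)} (hG : IsGabrielTopology R G)
    (hA : IsSimpleGTorsionFree R A G) : Module.annihilator R A ∈ GStar R G := by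
  refine ⟨hA.isPrime_annihilator, fun hmem => ?_, fun q hq hlt => ?_⟩
  · obtain ⟨htf, ⟨x, hx⟩, -⟩ := hA
    exact hx (htf _ hmem x fun r hr => Module.mem_annihilator.1 hr x)
  · by_contra hqG
    obtain ⟨r, hrq, hr⟩ := SetLike.exists_of_lt hlt
    refine hA.2.2 (saturatedPrimeSubmodule A q) (fun hbot => hr ?_) (fun htop => ?_)
      (isGTorsionFree_quotient_saturatedPrimeSubmodule A hG q hqG)
    · have : algebraMap R A r ∈ saturatedPrimeSubmodule A q :=
        ⟨1, q.one_notMem, r, hrq, one_smul _ _⟩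
      rw [hbot, Submodule.mem_bot] at this
      exact mem_annihilator_iff_algebraMap_eq_zero.2 this
    · have h1 : (1 : A) ∈ saturatedPrimeSubmodule A q := htop ▸ Submodule.mem_top
      obtain ⟨t, ht, s, hs, h⟩ := h1
      rw [← Algebra.algebraMap_eq_smul_one, ← sub_eq_zero, ← map_sub] at h
      have hts := hlt.le (mem_annihilator_iff_algebraMap_eq_zero.2 h)
      exact ht (by simpa using q.add_mem hts hs)

theorem isSimpleGTorsionFree_of_annihilator_mem_gStar {R A : Type*} [CommRing R]
    [IsNoetherianRing R] [CommRing A] [Algebra R A] (S : Submonoid R) [IsLocalization S A]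
    {G : Set (Ideal R)} (hG : IsGabrielTopology R G)
    (h : Module.annihilator R A ∈ GStar R G) : IsSimpleGTorsionFree R A G := by
  obtain ⟨hp, hpG, hmax⟩ := h
  have h1 : (1 : A) ≠ 0 := fun h1 => hp.one_notMem <|
    mem_annihilator_iff_algebraMap_eq_zero.2 (by rw [map_one, h1])
  have hS : ∀ s : S, (s : R) ∉ Module.annihilator R A := fun s hs => by
    have : Nontrivial A := ⟨1, 0, h1⟩
    exact (IsLocalization.map_units A s).ne_zero (mem_annihilator_iff_algebraMap_eq_zero.1 hs)
  have hmk : ∀ (b : R) (s : S),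
      IsLocalization.mk' A b s = 0 ↔ b ∈ Module.annihilator R A := fun b s => by
    rw [mem_annihilator_iff_algebraMap_eq_zero, IsLocalization.mk'_eq_zero_iff,
      IsLocalization.map_eq_zero_iff S A]
  refine ⟨fun a ha x hx => ?_, ⟨1, h1⟩, fun U hbot htop htf => ?_⟩
  · obtain ⟨b, s, rfl⟩ := IsLocalization.exists_mk'_eq S x
    rw [hmk]
    by_contra hb
    refine hpG (hG.2.1 a _ ha fun r hr => ?_)
    have h := hx r hr
    rw [IsLocalization.smul_mk', hmk] at h
    exact (hp.mem_or_mem h).resolve_right hb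
  · obtain ⟨u, huU, hu⟩ := U.ne_bot_iff.1 hbot
    obtain ⟨b, t, rfl⟩ := IsLocalization.exists_mk'_eq S u
    rw [Ne, hmk] at hu
    refine htop (eq_top_iff.2 fun m _ => ?_)
    obtain ⟨c, s, rfl⟩ := IsLocalization.exists_mk'_eq S m
    have hbs : b * s ∉ Module.annihilator R A :=
      fun hm => (hp.mem_or_mem hm).elim hu (hS s)
    have hmem : (b * s : R) • IsLocalization.mk' A c s ∈ U := by
      have : (b * s : R) • IsLocalization.mk' A c s = (c * t : R) • IsLocalization.mk' A b t := by
        rw [mul_smul, mul_smul, Algebra.smul_def (s : R), Algebra.smul_def (t : R),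
          IsLocalization.mk'_spec', IsLocalization.mk'_spec', Algebra.smul_def, Algebra.smul_def,
          mul_comm]
      rw [this]
      exact U.smul_mem _ huU
    have hI : Module.annihilator R A ⊔ Ideal.span {b * (s : R)} ∈ G := by
      refine hG.mem_of_forall_isPrime _ fun q hq hle => hmax q hq ?_
      refine lt_of_le_of_ne (le_sup_left.trans hle) fun he => hbs ?_
      rw [he]
      exact hle (Ideal.mem_sup_right (Ideal.mem_span_singleton_self _))
    rw [← Submodule.Quotient.mk_eq_zero]
    refine htf _ hI _ fun r hr => ?_
    rw [← Submodule.Quotient.mk_smul, Submodule.Quotient.mk_eq_zero]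
    obtain ⟨y, hy, z, hz, rfl⟩ := Submodule.mem_sup.1 hr
    obtain ⟨d, rfl⟩ := Ideal.mem_span_singleton'.1 hz
    rw [add_smul, Module.mem_annihilator.1 hy, zero_add, mul_smul]
    exact U.smul_mem _ hmem

theorem stmt11 (R : Type*) [CommRing R] [IsNoetherianRing R] [IsLocalRing R]
    (G : Set (Ideal R)) (hG : IsGabrielTopology R G)
    (S : Submonoid R) :
    IsSimpleGTorsionFree R (Localization S) G ↔
      Module.annihilator R (Localization S) ∈ GStar R G := by
  exact ⟨fun h => h.annihilator_mem_gStar hG,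
    isSimpleGTorsionFree_of_annihilator_mem_gStar S hG⟩
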